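/- Let θ_0 be a grid in ℝ^d with directions e_1,…,e_d, and let θ_l, l = 0,…,3^d−1, be the 3^d parallel grids obtained by shifting the origin of θ_0 by lattice vectors ε·Σ_{i=1}^d n_i e_i with n_i ∈ {0,1,2}. For every q > 1, the combined box partition function 𝛶̃_τ(θ_0,ε,q) := Σ_{l=0}^{3^d−1} Υ_τ(θ_l, 3ε, q) satisfies Γ_τ(ε,q) ≤ 𝛶̃_τ(θ_0,ε,q) ≤ 3^d·Γ_τ(3kε,q) (k a constant depending only on d), and consequently its limsup and liminf scaling exponents (1/(q-1))·log 𝛶̃_τ(θ_0,ε,q)/log ε as ε → 0 equal D_τ^+(q) and D_τ^-(q) respectively, independently of the choice of grid. -/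

import Mathlib

open MeasureTheory Filter Set
open scoped ENNReal Topology NNReal

noncomputable section

/-- First return time of `x` to the set `A` under the map `T`;
by convention it is `0` if the orbit of `x` never returns to `A`. -/
def firstReturn {α : Type*} (T : α → α) (A : Set α) (x : α) : ℕ :=
  sInf {k : ℕ | 0 < k ∧ T^[k] x ∈ A}

/-- Extended logarithm `ℝ≥0∞ → EReal`. -/
def elog (x : ℝ≥0∞) : EReal :=
  if x = 0 then ⊥ else if x = ⊤ then ⊤ else ((Real.log x.toReal : ℝ) : EReal)

section Generic

variable {α : Type*} [MeasurableSpace α] [PseudoMetricSpace α]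

/-- The measure partition function `Γ_μ(ε,q)`. -/
def measPF (μ : Measure α) (ε q : ℝ) : ℝ≥0∞ :=
  ∫⁻ x, μ (Metric.ball x ε) ^ (q - 1) ∂μ

/-- The logarithmic measure partition function `Γ^l_μ(ε)`. -/
def measPFlog (μ : Measure α) (ε : ℝ) : ℝ :=
  ∫ x, Real.log (μ (Metric.ball x ε)).toReal ∂μ

/-- The return time partition function `Γ_τ(ε,q)`. -/
def retPF (T : α → α) (μ : Measure α) (ε q : ℝ) : ℝ≥0∞ :=
  ∫⁻ x, (firstReturn T (Metric.ball x ε) x : ℝ≥0∞) ^ (1 - q) ∂μ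

/-- The logarithmic return time partition function `Γ^l_τ(ε)`. -/
def retPFlog (T : α → α) (μ : Measure α) (ε : ℝ) : ℝ :=
  ∫ x, Real.log ((firstReturn T (Metric.ball x ε) x : ℝ))⁻¹ ∂μ

/-- The scaling exponent `(1/(q-1)) · log F(ε) / log ε`. -/
def dimScale (F : ℝ → ℝ≥0∞) (q : ℝ) (ε : ℝ) : EReal :=
  ((((q - 1) * Real.log ε)⁻¹ : ℝ) : EReal) * elog (F ε)

/-- Upper generalized dimension obtained from a one-parameter family of partition
functions `F ε`, with the logarithmic convention at `q = 1`. -/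
def dimPlus (F : ℝ → ℝ≥0∞) (Flog : ℝ → ℝ) (q : ℝ) : EReal :=
  if q = 1 then ((limsup (fun ε => Flog ε / Real.log ε) (𝓝[>] (0:ℝ)) : ℝ) : EReal)
  else limsup (dimScale F q) (𝓝[>] (0:ℝ))

/-- Lower generalized dimension. -/
def dimMinus (F : ℝ → ℝ≥0∞) (Flog : ℝ → ℝ) (q : ℝ) : EReal :=
  if q = 1 then ((liminf (fun ε => Flog ε / Real.log ε) (𝓝[>] (0:ℝ)) : ℝ) : EReal)
  else liminf (dimScale F q) (𝓝[>] (0:ℝ))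

/-- Generalized measure dimensions `D_μ^+(q)`. -/
def DmuPlus (μ : Measure α) (q : ℝ) : EReal :=
  dimPlus (fun ε => measPF μ ε q) (measPFlog μ) q

/-- Generalized measure dimensions `D_μ^-(q)`. -/
def DmuMinus (μ : Measure α) (q : ℝ) : EReal :=
  dimMinus (fun ε => measPF μ ε q) (measPFlog μ) q

/-- Return time generalized dimensions `D_τ^+(q)`. -/
def DtauPlus (T : α → α) (μ : Measure α) (q : ℝ) : EReal :=
  dimPlus (fun ε => retPF T μ ε q) (retPFlog T μ) q

/-- Return time generalized dimensions `D_τ^-(q)`. -/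
def DtauMinus (T : α → α) (μ : Measure α) (q : ℝ) : EReal :=
  dimMinus (fun ε => retPF T μ ε q) (retPFlog T μ) q

end Generic

/-- Euclidean space `ℝ^n`. -/
abbrev Euc (n : ℕ) := EuclideanSpace ℝ (Fin n)

/-- A grid in `ℝ^n` : a choice of origin and orientation, determining for every
side length `ε` a partition of `ℝ^n` into half-open cubes of side `ε`. -/
structure Grid (n : ℕ) where
  origin : Euc n
  rot : Euc n ≃ₗᵢ[ℝ] Euc n

/-- Coordinates of a point w.r.t. a grid. -/
def Grid.coords {n : ℕ} (θ : Grid n) (x : Euc n) : Fin n → ℝ :=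
  fun i => θ.rot.symm (x - θ.origin) i

/-- The cube `A_j` of side `ε` of the grid `θ`, indexed by `j : Fin n → ℤ`. -/
def Grid.box {n : ℕ} (θ : Grid n) (ε : ℝ) (j : Fin n → ℤ) : Set (Euc n) :=
  {x | ∀ i, (j i : ℝ) * ε ≤ θ.coords x i ∧ θ.coords x i < ((j i : ℝ) + 1) * ε}

/-- The enlarged cube `Ā_j` of side `3ε` concentric with `A_j`. -/
def Grid.bigBox {n : ℕ} (θ : Grid n) (ε : ℝ) (j : Fin n → ℤ) : Set (Euc n) :=
  {x | ∀ i, ((j i : ℝ) - 1) * ε ≤ θ.coords x i ∧ θ.coords x i < ((j i : ℝ) + 2) * ε}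

/-- Box measure partition function `Υ_μ(θ,ε,q) = Σ_{μ(A_j)>0} μ(A_j)^q`. -/
def boxMeasPF {n : ℕ} (μ : Measure (Euc n)) (θ : Grid n) (ε q : ℝ) : ℝ≥0∞ :=
  ∑' j : Fin n → ℤ, if μ (θ.box ε j) = 0 then 0 else μ (θ.box ε j) ^ q

/-- Logarithmic box measure partition function `Υ^l_μ(θ,ε)`. -/
def boxMeasPFlog {n : ℕ} (μ : Measure (Euc n)) (θ : Grid n) (ε : ℝ) : ℝ :=
  ∑' j : Fin n → ℤ, (μ (θ.box ε j)).toReal * Real.log (μ (θ.box ε j)).toReal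

/-- Return time box partition function `Υ_τ(θ,ε,q)`. -/
def boxRetPF {n : ℕ} (T : Euc n → Euc n) (μ : Measure (Euc n)) (θ : Grid n)
    (ε q : ℝ) : ℝ≥0∞ :=
  ∑' j : Fin n → ℤ, ∫⁻ x in θ.box ε j,
    (firstReturn T (θ.box ε j) x : ℝ≥0∞) ^ (1 - q) ∂μ

/-- Logarithmic return time box partition function `Υ^l_τ(θ,ε)`. -/
def boxRetPFlog {n : ℕ} (T : Euc n → Euc n) (μ : Measure (Euc n)) (θ : Grid n)
    (ε : ℝ) : ℝ :=
  ∑' j : Fin n → ℤ, ∫ x in θ.box ε j,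
    Real.log ((firstReturn T (θ.box ε j) x : ℝ))⁻¹ ∂μ

/-- Riedi's enhanced box partition function `Φ_μ(θ,ε,q)`. -/
def riediPF {n : ℕ} (μ : Measure (Euc n)) (θ : Grid n) (ε q : ℝ) : ℝ≥0∞ :=
  ∑' j : Fin n → ℤ, if μ (θ.box ε j) = 0 then 0 else μ (θ.bigBox ε j) ^ q

/-- The enhanced box partition function `Ψ_μ(θ,ε,q) = Σ_{μ(A_j)>0} μ(A_j) μ(Ā_j)^{q-1}`. -/
def psiMeasPF {n : ℕ} (μ : Measure (Euc n)) (θ : Grid n) (ε q : ℝ) : ℝ≥0∞ :=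
  ∑' j : Fin n → ℤ,
    if μ (θ.box ε j) = 0 then 0 else μ (θ.box ε j) * μ (θ.bigBox ε j) ^ (q - 1)

/-- The logarithmic enhanced box partition function `Ψ^l_μ(θ,ε)`. -/
def psiMeasPFlog {n : ℕ} (μ : Measure (Euc n)) (θ : Grid n) (ε : ℝ) : ℝ :=
  ∑' j : Fin n → ℤ, (μ (θ.box ε j)).toReal * Real.log (μ (θ.bigBox ε j)).toReal

/-- The enhanced return time box partition function `Ψ_τ(θ,ε,q)`:
the integral is over `A_j` but the return is to the enlarged box `Ā_j`. -/
def psiRetPF {n : ℕ} (T : Euc n → Euc n) (μ : Measure (Euc n)) (θ : Grid n)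
    (ε q : ℝ) : ℝ≥0∞ :=
  ∑' j : Fin n → ℤ, ∫⁻ x in θ.box ε j,
    (firstReturn T (θ.bigBox ε j) x : ℝ≥0∞) ^ (1 - q) ∂μ

/-- Box measure dimensions `Δ_μ^+(θ,q)`. -/
def DeltaMuPlus {n : ℕ} (μ : Measure (Euc n)) (θ : Grid n) (q : ℝ) : EReal :=
  dimPlus (fun ε => boxMeasPF μ θ ε q) (boxMeasPFlog μ θ) q

/-- Box measure dimensions `Δ_μ^-(θ,q)`. -/
def DeltaMuMinus {n : ℕ} (μ : Measure (Euc n)) (θ : Grid n) (q : ℝ) : EReal :=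
  dimMinus (fun ε => boxMeasPF μ θ ε q) (boxMeasPFlog μ θ) q

/-- Box return time dimensions `Δ_τ^+(θ,q)`. -/
def DeltaTauPlus {n : ℕ} (T : Euc n → Euc n) (μ : Measure (Euc n)) (θ : Grid n)
    (q : ℝ) : EReal :=
  dimPlus (fun ε => boxRetPF T μ θ ε q) (boxRetPFlog T μ θ) q

/-- Box return time dimensions `Δ_τ^-(θ,q)`. -/
def DeltaTauMinus {n : ℕ} (T : Euc n → Euc n) (μ : Measure (Euc n)) (θ : Grid n)
    (q : ℝ) : EReal :=
  dimMinus (fun ε => boxRetPF T μ θ ε q) (boxRetPFlog T μ θ) q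

end

/-- The grid parallel to `θ`, with origin shifted by the lattice vector
`ε · Σ_i ν i · e_i`, where the `e_i` are the directions of `θ` and `ν i ∈ {0,1,2}`. -/
noncomputable def Grid.shift {d : ℕ} (θ : Grid d) (ε : ℝ) (ν : Fin d → Fin 3) : Grid d :=
  ⟨θ.origin + θ.rot ((WithLp.equiv 2 (Fin d → ℝ)).symm fun i => (ν i : ℝ) * ε), θ.rot⟩

/-- The combined box partition function `𝛶̃_τ(θ₀,ε,q) = Σ_{l=0}^{3^d-1} Υ_τ(θ_l, 3ε, q)`,
summing over the `3^d` parallel shifted grids of side `3ε`. -/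
noncomputable def combinedRetPF {d : ℕ} (T : Euc d → Euc d) (μ : Measure (Euc d))
    (θ₀ : Grid d) (ε q : ℝ) : ℝ≥0∞ :=
  ∑ ν : Fin d → Fin 3, boxRetPF T μ (θ₀.shift ε ν) (3 * ε) q

section FirstReturn

variable {α : Type*} {T : α → α} {A B : Set α} {x : α}

lemma firstReturn_le_of_subset (hAB : A ⊆ B) (h : ∃ n, 0 < n ∧ T^[n] x ∈ A) :
    firstReturn T B x ≤ firstReturn T A x := by
  have hmem := Nat.sInf_mem (s := {k : ℕ | 0 < k ∧ T^[k] x ∈ A}) h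
  exact Nat.sInf_le ⟨hmem.1, hAB hmem.2⟩

lemma firstReturn_rpow_le_of_subset {q : ℝ} (hq : 1 < q) (hAB : A ⊆ B)
    (h : ∃ n, 0 < n ∧ T^[n] x ∈ A) :
    (firstReturn T A x : ℝ≥0∞) ^ (1 - q) ≤ (firstReturn T B x : ℝ≥0∞) ^ (1 - q) := by
  rw [← neg_sub q 1, ENNReal.rpow_neg, ENNReal.rpow_neg, ENNReal.inv_le_inv]
  exact ENNReal.rpow_le_rpow (by exact_mod_cast firstReturn_le_of_subset hAB h) (by linarith)

/-- Poincaré recurrence for a fixed set. -/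
lemma ae_exists_return [MeasurableSpace α] {μ : Measure α} (hT : Conservative T μ)
    (hA : MeasurableSet A) : ∀ᵐ x ∂μ, x ∈ A → ∃ n, 0 < n ∧ T^[n] x ∈ A := by
  filter_upwards [hT.ae_mem_imp_frequently_image_mem hA.nullMeasurableSet] with x hx hxA
  obtain ⟨n, hn, hn'⟩ := ((hx hxA).and_eventually (eventually_gt_atTop 0)).exists
  exact ⟨n, hn', hn⟩

/-- Poincaré recurrence: almost every point returns to every ball around itself. -/
lemma ae_forall_exists_return_ball [PseudoMetricSpace α] [SecondCountableTopology α]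
    [MeasurableSpace α] [OpensMeasurableSpace α] {μ : Measure α} (hT : Conservative T μ) :
    ∀ᵐ x ∂μ, ∀ ε : ℝ, 0 < ε → ∃ n, 0 < n ∧ T^[n] x ∈ Metric.ball x ε := by
  filter_upwards [hT.ae_frequently_mem_of_mem_nhds] with x hx ε hε
  obtain ⟨n, hn, hn'⟩ :=
    ((hx _ (Metric.ball_mem_nhds x hε)).and_eventually (eventually_gt_atTop 0)).exists
  exact ⟨n, hn', hn⟩

end FirstReturn

namespace Grid

variable {d : ℕ}

lemma measurable_coords (θ : Grid d) (i : Fin d) : Measurable fun x => θ.coords x i := by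
  have : Continuous fun x => θ.coords x i := by
    unfold Grid.coords
    fun_prop
  exact this.measurable

lemma measurableSet_box (θ : Grid d) (ε : ℝ) (j : Fin d → ℤ) : MeasurableSet (θ.box ε j) := by
  have : θ.box ε j = ⋂ i, (fun x => θ.coords x i) ⁻¹' Ico ((j i : ℝ) * ε) (((j i : ℝ) + 1) * ε) := by
    ext x
    simp [Grid.box]
  rw [this]
  exact MeasurableSet.iInter fun i => θ.measurable_coords i measurableSet_Ico

lemma mem_box_iff_floor (θ : Grid d) {ε : ℝ} (hε : 0 < ε) (j : Fin d → ℤ) (x : Euc d) :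
    x ∈ θ.box ε j ↔ (fun i => ⌊θ.coords x i / ε⌋) = j := by
  rw [funext_iff]
  refine forall_congr' fun i => ?_
  rw [Int.floor_eq_iff, le_div_iff₀ hε, div_lt_iff₀ hε]

lemma iUnion_box (θ : Grid d) {ε : ℝ} (hε : 0 < ε) : ⋃ j, θ.box ε j = univ :=
  eq_univ_of_forall fun x => mem_iUnion.2 ⟨_, (θ.mem_box_iff_floor hε _ x).2 rfl⟩

lemma pairwise_disjoint_box (θ : Grid d) {ε : ℝ} (hε : 0 < ε) :
    Pairwise (Function.onFun Disjoint (θ.box ε)) := by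
  intro i j hij
  refine disjoint_left.2 fun x hi hj => hij ?_
  rw [θ.mem_box_iff_floor hε] at hi hj
  exact hi.symm.trans hj

lemma origin_mem_box_zero (θ : Grid d) {ε : ℝ} (hε : 0 < ε) : θ.origin ∈ θ.box ε 0 := by
  simp [Grid.box, Grid.coords, hε]

lemma coords_shift (θ : Grid d) (ε : ℝ) (ν : Fin d → Fin 3) (x : Euc d) (i : Fin d) :
    (θ.shift ε ν).coords x i = θ.coords x i - (ν i : ℝ) * ε := by
  simp [Grid.shift, Grid.coords, sub_add_eq_sub_sub]

lemma abs_coords_sub_coords_le_dist (θ : Grid d) (x y : Euc d) (i : Fin d) :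
    |θ.coords x i - θ.coords y i| ≤ dist x y := by
  have h := PiLp.norm_apply_le (θ.rot.symm (x - y)) i
  rw [LinearIsometryEquiv.norm_map, ← dist_eq_norm] at h
  convert h using 1
  simp [Grid.coords]

/-- The index in `θ` of the central cube of side `ε` of the cube of side `3ε` with index `m`
in the grid shifted by `ν`. -/
def centralIndex (p : (Fin d → Fin 3) × (Fin d → ℤ)) : Fin d → ℤ :=
  fun i => 3 * p.2 i + (p.1 i : ℕ) + 1

lemma centralIndex_surjective :
    Function.Surjective (centralIndex : (Fin d → Fin 3) × (Fin d → ℤ) → Fin d → ℤ) := by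
  intro j
  refine ⟨(fun i => ⟨((j i - 1) % 3).toNat, by omega⟩, fun i => (j i - 1) / 3), ?_⟩
  funext i
  simp only [centralIndex]
  omega

lemma ball_subset_box_shift (θ : Grid d) {ε : ℝ} {ν : Fin d → Fin 3} {m : Fin d → ℤ}
    {x : Euc d} (hx : x ∈ θ.box ε (centralIndex (ν, m))) :
    Metric.ball x ε ⊆ (θ.shift ε ν).box (3 * ε) m := by
  intro y hy i
  have hd := abs_le.1 (θ.abs_coords_sub_coords_le_dist y x i)
  have hlt := Metric.mem_ball.1 hy
  have hi := hx i
  simp only [centralIndex] at hi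
  push_cast at hi
  rw [coords_shift]
  constructor <;> nlinarith

lemma lintegral_le_combinedRetPF (θ : Grid d) (T : Euc d → Euc d) (μ : Measure (Euc d))
    {f : Euc d → ℝ≥0∞} {ε q : ℝ} (hε : 0 < ε)
    (hf : ∀ (ν : Fin d → Fin 3) (m : Fin d → ℤ), ∀ᵐ x ∂μ, x ∈ θ.box ε (centralIndex (ν, m)) →
      f x ≤ (firstReturn T ((θ.shift ε ν).box (3 * ε) m) x : ℝ≥0∞) ^ (1 - q)) :
    ∫⁻ x, f x ∂μ ≤ combinedRetPF T μ θ ε q := by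
  have hU : ⋃ p, θ.box ε (centralIndex p) = univ := by
    rw [← θ.iUnion_box hε]
    exact centralIndex_surjective.iUnion_comp (θ.box ε)
  calc ∫⁻ x, f x ∂μ = ∫⁻ x in ⋃ p, θ.box ε (centralIndex p), f x ∂μ := by
        rw [hU, Measure.restrict_univ]
    _ ≤ ∑' p, ∫⁻ x in θ.box ε (centralIndex p), f x ∂μ := lintegral_iUnion_le _ _
    _ = ∑ ν, ∑' m, ∫⁻ x in θ.box ε (centralIndex (ν, m)), f x ∂μ := by
        rw [ENNReal.tsum_prod', tsum_fintype]
    _ ≤ combinedRetPF T μ θ ε q := by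
        refine Finset.sum_le_sum fun ν _ => ENNReal.tsum_le_tsum fun m => ?_
        refine (lintegral_mono_ae ?_).trans (lintegral_mono_set ?_)
        · refine (ae_restrict_iff' (θ.measurableSet_box _ _)).2 ?_
          exact hf ν m
        · exact fun x hx => θ.ball_subset_box_shift hx (Metric.mem_ball_self hε)

end Grid

lemma boxRetPF_le_retPF {d : ℕ} {T : Euc d → Euc d} {μ : Measure (Euc d)}
    (hT : Conservative T μ) (θ : Grid d) {ε r q : ℝ} (hε : 0 < ε) (hq : 1 < q)
    (hr : ∀ (j : Fin d → ℤ), ∀ x ∈ θ.box ε j, θ.box ε j ⊆ Metric.ball x r) :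
    boxRetPF T μ θ ε q ≤ retPF T μ r q := by
  unfold boxRetPF retPF
  rw [← setLIntegral_univ, ← θ.iUnion_box hε,
    lintegral_iUnion (θ.measurableSet_box ε) (θ.pairwise_disjoint_box hε)]
  refine ENNReal.tsum_le_tsum fun j => lintegral_mono_ae ?_
  refine (ae_restrict_iff' (θ.measurableSet_box _ _)).2 ?_
  filter_upwards [ae_exists_return hT (θ.measurableSet_box ε j)] with x hx hxj
  exact firstReturn_rpow_le_of_subset hq (hr j x hxj) (hx hxj)

lemma retPF_le_combinedRetPF {d : ℕ} {T : Euc d → Euc d} {μ : Measure (Euc d)}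
    (hT : Conservative T μ) (θ : Grid d) {ε q : ℝ} (hε : 0 < ε) (hq : 1 < q) :
    retPF T μ ε q ≤ combinedRetPF T μ θ ε q := by
  refine θ.lintegral_le_combinedRetPF T μ hε fun ν m => ?_
  filter_upwards [ae_forall_exists_return_ball hT] with x hx hxm
  exact firstReturn_rpow_le_of_subset hq (θ.ball_subset_box_shift hxm) (hx ε hε)

lemma combinedRetPF_le_retPF {d : ℕ} {T : Euc d → Euc d} {μ : Measure (Euc d)}
    (hT : Conservative T μ) (θ : Grid d) {ε r q : ℝ} (hε : 0 < ε) (hq : 1 < q)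
    (hr : ∀ (θ : Grid d) (j : Fin d → ℤ), ∀ x ∈ θ.box (3 * ε) j,
      θ.box (3 * ε) j ⊆ Metric.ball x r) :
    combinedRetPF T μ θ ε q ≤ (3 : ℝ≥0∞) ^ d * retPF T μ r q := by
  refine (Finset.sum_le_card_nsmul _ _ _ fun ν _ =>
    boxRetPF_le_retPF hT (θ.shift ε ν) (by positivity) hq (hr _)).trans_eq ?_
  simp

section Scaling

lemma limsup_liminf_le_of_forall_real {ι : Type*} {l : Filter ι} {u v : ι → EReal}
    (h : ∀ a b : ℝ, a < b → ∀ᶠ i in l, (b : EReal) < u i → (a : EReal) < v i) :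
    limsup u l ≤ limsup v l ∧ liminf u l ≤ liminf v l := by
  constructor <;> refine le_of_forall_lt_imp_le_of_dense fun c hc => ?_
  all_goals
    obtain ⟨a, hca, ha⟩ := EReal.lt_iff_exists_real_btwn.1 hc
    obtain ⟨b, hab, hb⟩ := EReal.lt_iff_exists_real_btwn.1 ha
    have hev := h a b (EReal.coe_lt_coe_iff.1 hab)
    refine hca.le.trans ?_
  · refine le_limsup_of_frequently_le' ?_
    exact ((frequently_lt_of_lt_limsup (by isBoundedDefault) hb).and_eventually hev).mono
      fun i hi => (hi.2 hi.1).le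
  · refine le_liminf_of_le (by isBoundedDefault) ?_
    filter_upwards [eventually_lt_of_lt_liminf hb, hev] with i h1 h2 using (h2 h1).le

lemma lt_dimScale_iff (F : ℝ → ℝ≥0∞) {q ε : ℝ} (hq : 1 < q) (hε : 0 < ε) (hε1 : ε < 1) (a : ℝ) :
    (a : EReal) < dimScale F q ε ↔ F ε ≠ ⊤ ∧
      (F ε = 0 ∨ Real.log (F ε).toReal < a * ((q - 1) * Real.log ε)) := by
  have hneg : (q - 1) * Real.log ε < 0 :=
    mul_neg_of_pos_of_neg (by linarith) (Real.log_neg hε hε1)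
  have hinv := inv_lt_zero.2 hneg
  unfold dimScale elog
  by_cases h0 : F ε = 0
  · rw [if_pos h0, EReal.coe_mul_bot_of_neg hinv]
    simp [h0]
  by_cases htop : F ε = ⊤
  · rw [if_neg h0, if_pos htop, EReal.coe_mul_top_of_neg hinv]
    simp [htop]
  rw [if_neg h0, if_neg htop, ← EReal.coe_mul, EReal.coe_lt_coe_iff, inv_mul_eq_div,
    lt_div_iff_of_neg hneg]
  simp [h0, htop]

lemma map_const_mul_nhdsGT_zero {c : ℝ} (hc : 0 < c) :
    map (c * ·) (𝓝[>] (0 : ℝ)) = 𝓝[>] 0 := by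
  have key : ∀ {b : ℝ}, 0 < b → Tendsto (b * ·) (𝓝[>] (0 : ℝ)) (𝓝[>] 0) := fun {b} hb => by
    refine tendsto_nhdsWithin_iff.2 ⟨?_, ?_⟩
    · refine tendsto_nhdsWithin_of_tendsto_nhds ?_
      simpa using (continuous_const_mul b).tendsto (0 : ℝ)
    · filter_upwards [self_mem_nhdsWithin] with x hx using mul_pos hb hx
  refine le_antisymm (key hc) ?_
  have h := map_mono (m := (c * ·)) (key (inv_pos.2 hc))
  rwa [map_map, show (c * ·) ∘ (c⁻¹ * ·) = (id : ℝ → ℝ) by funext x; simp [hc.ne'], map_id] at h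

/-- If `F ε ≤ K · G (c ε)` for constants `K` and `c`, then the scaling exponents of `G` are at
most those of `F`. -/
lemma limsup_liminf_dimScale_le {F G : ℝ → ℝ≥0∞} {K : ℝ≥0∞} {c q : ℝ} (hq : 1 < q) (hc : 0 < c)
    (hK : K ≠ ⊤) (hFG : ∀ ε, 0 < ε → F ε ≤ K * G (c * ε)) :
    limsup (dimScale G q) (𝓝[>] 0) ≤ limsup (dimScale F q) (𝓝[>] 0) ∧
      liminf (dimScale G q) (𝓝[>] 0) ≤ liminf (dimScale F q) (𝓝[>] 0) := by
  have hmap := map_const_mul_nhdsGT_zero hc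
  suffices h : limsup (dimScale G q ∘ (c * ·)) (𝓝[>] 0) ≤ limsup (dimScale F q) (𝓝[>] 0) ∧
      liminf (dimScale G q ∘ (c * ·)) (𝓝[>] 0) ≤ liminf (dimScale F q) (𝓝[>] 0) by
    rwa [limsup_comp, liminf_comp, hmap] at h
  refine limsup_liminf_le_of_forall_real fun a b hab => ?_
  have hlt1 : ∀ᶠ ε in 𝓝[>] (0 : ℝ), ε < 1 :=
    eventually_nhdsWithin_of_eventually_nhds (eventually_lt_nhds one_pos)
  have hltc : ∀ᶠ ε in 𝓝[>] (0 : ℝ), c * ε < 1 := by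
    have h : ∀ᶠ r in map (c * ·) (𝓝[>] (0 : ℝ)), r < 1 := by rwa [hmap]
    exact h
  have hlog := Real.tendsto_log_nhdsGT_zero.const_mul_atBot
    (mul_pos (sub_pos.2 hab) (sub_pos.2 hq))
  filter_upwards [self_mem_nhdsWithin, hlt1, hltc,
    hlog.eventually_le_atBot (-(Real.log K.toReal + b * (q - 1) * Real.log c))]
    with ε (hε : 0 < ε) hε1 hcε1 hle hb
  rw [Function.comp_apply, lt_dimScale_iff G hq (mul_pos hc hε) hcε1] at hb
  rw [lt_dimScale_iff F hq hε hε1]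
  have hF := hFG ε hε
  have hKG : K * G (c * ε) ≠ ⊤ := ENNReal.mul_ne_top hK hb.1
  refine ⟨ne_top_of_le_ne_top hKG hF, or_iff_not_imp_left.2 fun hF0 => ?_⟩
  have hKG0 : K * G (c * ε) ≠ 0 := fun h => hF0 (le_zero_iff.1 (hF.trans_eq h))
  have hK0 : K ≠ 0 := left_ne_zero_of_mul hKG0
  have hG0 : G (c * ε) ≠ 0 := right_ne_zero_of_mul hKG0
  have hG := hb.2.resolve_left hG0
  have hlogF := Real.log_le_log (ENNReal.toReal_pos hF0 (ne_top_of_le_ne_top hKG hF))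
    (ENNReal.toReal_mono hKG hF)
  rw [ENNReal.toReal_mul, Real.log_mul (ENNReal.toReal_pos hK0 hK).ne'
    (ENNReal.toReal_pos hG0 hb.1).ne'] at hlogF
  rw [Real.log_mul hc.ne' hε.ne'] at hG
  linarith

end Scaling

/-- For `q > 1`, `Γ_τ(ε,q) ≤ 𝛶̃_τ(θ₀,ε,q) ≤ 3^d·Γ_τ(3kε,q)`, and
consequently the scaling exponents of `𝛶̃_τ` equal the generalized return time
dimensions `D_τ^±(q)`, independently of the grid. -/
theorem combined_box_partition_function_dimensions {d : ℕ} (T : Euc d → Euc d)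
    (μ : Measure (Euc d)) [IsProbabilityMeasure μ] (X : Set (Euc d))
    (hXc : IsCompact X) (hX1 : μ X = 1) (hTX : Set.MapsTo T X X)
    (hErg : Ergodic T μ) (k : ℝ)
    (hk : ∀ (θ : Grid d) (ε : ℝ), 0 < ε → ∀ (j : Fin d → ℤ) (x : Euc d),
      x ∈ θ.box ε j → θ.box ε j ⊆ Metric.ball x (k * ε)) :
    ∀ (θ₀ : Grid d) (q : ℝ), 1 < q →
      (∀ ε : ℝ, 0 < ε →
        retPF T μ ε q ≤ combinedRetPF T μ θ₀ ε q ∧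
          combinedRetPF T μ θ₀ ε q ≤ (3 : ℝ≥0∞) ^ d * retPF T μ (3 * k * ε) q) ∧
      Filter.limsup (dimScale (fun ε => combinedRetPF T μ θ₀ ε q) q) (𝓝[>] (0:ℝ)) =
        DtauPlus T μ q ∧
      Filter.liminf (dimScale (fun ε => combinedRetPF T μ θ₀ ε q) q) (𝓝[>] (0:ℝ)) =
        DtauMinus T μ q := by
  have hT : Conservative T μ := hErg.toMeasurePreserving.conservative
  have hk0 : 0 < k := by
    let θ : Grid d := ⟨0, LinearIsometryEquiv.refl ℝ _⟩
    have hmem := θ.origin_mem_box_zero one_pos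
    simpa using Metric.pos_of_mem_ball (hk θ 1 one_pos 0 _ hmem hmem)
  intro θ₀ q hq
  have hlower : ∀ ε : ℝ, 0 < ε → retPF T μ ε q ≤ combinedRetPF T μ θ₀ ε q :=
    fun ε hε => retPF_le_combinedRetPF hT θ₀ hε hq
  have hupper : ∀ ε : ℝ, 0 < ε →
      combinedRetPF T μ θ₀ ε q ≤ (3 : ℝ≥0∞) ^ d * retPF T μ (3 * k * ε) q := fun ε hε =>
    combinedRetPF_le_retPF hT θ₀ hε hq fun θ j x hx => by
      rw [show 3 * k * ε = k * (3 * ε) by ring]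
      exact hk θ (3 * ε) (by positivity) j x hx
  have h1 := limsup_liminf_dimScale_le (F := fun ε => retPF T μ ε q)
    (G := fun ε => combinedRetPF T μ θ₀ ε q) (K := 1) (c := 1) hq one_pos ENNReal.one_ne_top
    (by simpa using hlower)
  have h2 := limsup_liminf_dimScale_le (F := fun ε => combinedRetPF T μ θ₀ ε q)
    (G := fun ε => retPF T μ ε q) hq (by positivity) (ENNReal.pow_ne_top ENNReal.ofNat_ne_top)
    hupper
  rw [DtauPlus, DtauMinus, dimPlus, dimMinus, if_neg hq.ne', if_neg hq.ne']
  exact ⟨fun ε hε => ⟨hlower ε hε, hupper ε hε⟩, h1.1.antisymm h2.1, h1.2.antisymm h2.2⟩
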